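/- arXiv:2508.12528 — 6 statements merged into one kernel-verified Lean document; each statement's English description precedes it below -/
import Mathlib

section
/- Let m be a positive integer and n ≥ 3. For 1 ≤ i ≤ n let f_i : I_i → ℝ be a smooth function on an open interval with f_i'(t) ≠ 0 for all t ∈ I_i. Suppose that for all (u_1,…,u_n) ∈ I_1 × ⋯ × I_n the translation minimality equation Σ_{j=1}^n (f_j'(u_j))^{-(2m-2)/(2m-1)} · f_j''(u_j) · (1 + Σ_{i≠j} (f_i'(u_i))^{2m/(2m-1)}) = 0 holds. Then there are at least n−2 indices j for which f_j'' vanishes identically on I_j; that is, the translation hypersurface x_{n+1} = f_1(u_1)+⋯+f_n(u_n) is either a hyperplane or a cylinder over a translation minimal surface in a 3-space. -/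
/-- The real `(2m-1)`-th root of `y`: the unique real number `s` with `s^(2m-1) = y`.
For `y ≠ 0`, the fractional power `y^(p/(2m-1))` is interpreted as `(oddRoot m y)^p`. -/
noncomputable def oddRoot (m : ℕ) (y : ℝ) : ℝ :=
  Real.sign y * |y| ^ ((2 * (m : ℝ) - 1)⁻¹)

theorem sum_apply_update {ι : Type*} [Fintype ι] [DecidableEq ι] {α : ι → Type*}
    (G : ∀ i, α i → ℝ) (u : ∀ i, α i) (i : ι) (x : α i) :
    ∑ k, G k (Function.update u i x k) = ∑ k, G k (u k) + (G i x - G i (u i)) := by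
  rw [← Finset.add_sum_erase _ _ (Finset.mem_univ i),
    ← Finset.add_sum_erase _ (fun k => G k (u k)) (Finset.mem_univ i),
    Finset.sum_congr rfl fun k hk => by
      rw [Function.update_of_ne (Finset.ne_of_mem_erase hk)]]
  simp only [Function.update_self]
  ring

section SeparatedEquation

variable {ι : Type*} [Fintype ι] [DecidableEq ι] {α : ι → Type*} {P Q : ∀ i, α i → ℝ}

theorem sum_mul_one_add_sum_erase (u : ∀ i, α i) :
    ∑ j, P j (u j) * (1 + ∑ i ∈ Finset.univ.erase j, Q i (u i))
      = (∑ j, P j (u j)) * (1 + ∑ i, Q i (u i)) - ∑ j, P j (u j) * Q j (u j) := by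
  rw [Finset.sum_mul, ← Finset.sum_sub_distrib]
  refine Finset.sum_congr rfl fun j _ => ?_
  rw [← Finset.add_sum_erase _ (fun i => Q i (u i)) (Finset.mem_univ j)]
  ring

variable (h : ∀ u : ∀ i, α i,
  (∑ j, P j (u j)) * (1 + ∑ i, Q i (u i)) - ∑ j, P j (u j) * Q j (u j) = 0)

include h

theorem mixed_difference_eq_zero (u : ∀ i, α i) {i j : ι} (hij : i ≠ j)
    (x x' : α i) (y y' : α j) :
    (P i x - P i x') * (Q j y - Q j y') + (P j y - P j y') * (Q i x - Q i x') = 0 := by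
  have key : ∀ (x : α i) (y : α j), _ := fun x y =>
    h (Function.update (Function.update u i x) j y)
  simp only [sum_apply_update, sum_apply_update (fun k t => P k t * Q k t),
    Function.update_of_ne hij.symm] at key
  linear_combination key x y - key x' y - key x y' + key x' y'

theorem eq_of_three_nonconstant (u : ∀ i, α i) {i j k : ι}
    (hij : i ≠ j) (hik : i ≠ k) (hjk : j ≠ k)
    (hj : ∃ y y', Q j y ≠ Q j y') (hk : ∃ z z', Q k z ≠ Q k z') (x x' : α i) :
    P i x = P i x' := by
  obtain ⟨y, y', hy⟩ := hj
  obtain ⟨z, z', hz⟩ := hk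
  have e₁ := mixed_difference_eq_zero h u hij x x' y y'
  have e₂ := mixed_difference_eq_zero h u hik x x' z z'
  have e₃ := mixed_difference_eq_zero h u hjk y y' z z'
  have e : 2 * ((P i x - P i x') * ((Q j y - Q j y') * (Q k z - Q k z'))) = 0 := by
    linear_combination (Q k z - Q k z') * e₁ + (Q j y - Q j y') * e₂ - (Q i x - Q i x') * e₃
  simpa [sub_eq_zero, hy, hz] using e

theorem eq_sum_of_constant (u : ∀ i, α i) {i : ι} (hP : ∀ x x', P i x = P i x')
    (hQ : ∃ x x', Q i x ≠ Q i x') : P i (u i) = ∑ j, P j (u j) := by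
  obtain ⟨x, x', hx⟩ := hQ
  have key : ∀ x : α i, _ := fun x => h (Function.update u i x)
  simp only [sum_apply_update, sum_apply_update (fun k t => P k t * Q k t), hP _ (u i)] at key
  have e : (P i (u i) - ∑ j, P j (u j)) * (Q i x - Q i x') = 0 := by
    linear_combination key x' - key x
  simpa [sub_eq_zero, hx] using e

theorem card_le_two_of_separated_equation (T : Finset ι)
    (hT : ∀ i, i ∈ T ↔ ∃ x, P i x ≠ 0) (hQ : ∀ i ∈ T, ∃ x x', Q i x ≠ Q i x')
    (u : ∀ i, α i) : T.card ≤ 2 := by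
  by_contra! hcard
  have hconst : ∀ i ∈ T, ∀ x x', P i x = P i x' := by
    intro i hi
    have : 1 < (T.erase i).card := by
      rw [Finset.card_erase_of_mem hi]
      omega
    obtain ⟨j, hj, k, hk, hjk⟩ := Finset.one_lt_card.1 this
    rw [Finset.mem_erase] at hj hk
    exact eq_of_three_nonconstant h u hj.1.symm hk.1.symm hjk (hQ j hj.2) (hQ k hk.2)
  have hsum : ∀ i ∈ T, P i (u i) = ∑ j, P j (u j) := fun i hi =>
    eq_sum_of_constant h u (hconst i hi) (hQ i hi)
  have htotal : ∑ j, P j (u j) = T.card * ∑ j, P j (u j) := by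
    rw [← nsmul_eq_mul, ← Finset.sum_const, ← Finset.sum_congr rfl hsum]
    refine (Finset.sum_subset (Finset.subset_univ T) fun j _ hj => ?_).symm
    by_contra hne
    exact hj ((hT j).2 ⟨_, hne⟩)
  have hzero : ∑ j, P j (u j) = 0 := by
    have hne : (1 : ℝ) - T.card ≠ 0 := by
      have : (2 : ℝ) < T.card := by exact_mod_cast hcard
      linarith
    have : (1 - (T.card : ℝ)) * ∑ j, P j (u j) = 0 := by linear_combination htotal
    exact (mul_eq_zero.1 this).resolve_left hne
  obtain ⟨i, hi⟩ : T.Nonempty := Finset.card_pos.1 (by omega)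
  obtain ⟨x, hx⟩ := (hT i).1 hi
  exact hx (by rw [hconst i hi x (u i), hsum i hi, hzero])

end SeparatedEquation

theorem abs_oddRoot (m : ℕ) {y : ℝ} (hy : y ≠ 0) :
    |oddRoot m y| = |y| ^ ((2 * (m : ℝ) - 1)⁻¹) := by
  have hs : |Real.sign y| = 1 := by
    rcases Real.sign_apply_eq_of_ne_zero y hy with h | h <;> simp [h]
  rw [oddRoot, abs_mul, hs, one_mul, abs_of_nonneg (by positivity)]

theorem oddRoot_ne_zero (m : ℕ) {y : ℝ} (hy : y ≠ 0) : oddRoot m y ≠ 0 := by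
  rw [← abs_pos, abs_oddRoot m hy]
  positivity

theorem sq_eq_sq_of_oddRoot_pow_eq {m : ℕ} (hm : 1 ≤ m) {y z : ℝ} (hy : y ≠ 0) (hz : z ≠ 0)
    (h : oddRoot m y ^ (2 * m) = oddRoot m z ^ (2 * m)) : y ^ 2 = z ^ 2 := by
  have heven : Even (2 * m) := even_two_mul m
  rw [← heven.pow_abs, ← heven.pow_abs (oddRoot m z),
    pow_left_inj₀ (abs_nonneg _) (abs_nonneg _) (by omega), abs_oddRoot m hy, abs_oddRoot m hz,
    Real.rpow_left_inj (abs_nonneg _) (abs_nonneg _)] at h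
  · rw [← sq_abs, h, sq_abs]
  · have : (1 : ℝ) ≤ m := by exact_mod_cast hm
    exact inv_ne_zero (by linarith)

theorem deriv_eq_zero_of_sq_eqOn {g : ℝ → ℝ} {s : Set ℝ} (hs : IsOpen s)
    {t : ℝ} (ht : t ∈ s) (hg : g t ≠ 0) (h : ∀ x ∈ s, g x ^ 2 = g t ^ 2) : deriv g t = 0 := by
  by_cases hd : DifferentiableAt ℝ g t
  · have h₁ : HasDerivAt (fun x => g x ^ 2) 0 t :=
      (hasDerivAt_const t (g t ^ 2)).congr_of_eventuallyEq
        (Filter.eventually_of_mem (hs.mem_nhds ht) h)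
    simpa [hg] using (hd.hasDerivAt.fun_pow 2).unique h₁
  · exact deriv_zero_of_not_differentiableAt hd

/-- if a translation hypersurface
`x_{n+1} = f₁(u₁)+⋯+f_n(u_n)` in `(ℝ^{n+1}, ‖·‖_{2m})`, `n ≥ 3`, is minimal, then
at least `n-2` of the functions `f_j` have identically vanishing second derivative
(so the hypersurface is a hyperplane or a cylinder over a translation minimal
surface in a 3-space). -/
theorem translation_minimal_hypersurface_cylinder (m n : ℕ) (hm : 1 ≤ m) (hn : 3 ≤ n)
    (a b : Fin n → ℝ) (hab : ∀ i, a i < b i)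
    (f : Fin n → ℝ → ℝ)
    (hf : ∀ i, ContDiffOn ℝ (⊤ : ℕ∞) (f i) (Set.Ioo (a i) (b i)))
    (hf1 : ∀ i, ∀ t ∈ Set.Ioo (a i) (b i), deriv (f i) t ≠ 0)
    (hmin : ∀ u : Fin n → ℝ, (∀ i, u i ∈ Set.Ioo (a i) (b i)) →
        ∑ j, ((oddRoot m (deriv (f j) (u j))) ^ (2 * m - 2))⁻¹
            * deriv (deriv (f j)) (u j)
            * (1 + ∑ i ∈ Finset.univ.erase j,
                (oddRoot m (deriv (f i) (u i))) ^ (2 * m)) = 0) :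
    ∃ S : Finset (Fin n), n - 2 ≤ S.card ∧
      ∀ j ∈ S, ∀ t ∈ Set.Ioo (a j) (b j), deriv (deriv (f j)) t = 0 := by
  classical
  let P : ∀ j, Set.Ioo (a j) (b j) → ℝ := fun j t =>
    ((oddRoot m (deriv (f j) t)) ^ (2 * m - 2))⁻¹ * deriv (deriv (f j)) t
  let Q : ∀ j, Set.Ioo (a j) (b j) → ℝ := fun j t => (oddRoot m (deriv (f j) t)) ^ (2 * m)
  have hsep : ∀ u : ∀ j, Set.Ioo (a j) (b j),
      (∑ j, P j (u j)) * (1 + ∑ i, Q i (u i)) - ∑ j, P j (u j) * Q j (u j) = 0 := fun u => by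
    rw [← sum_mul_one_add_sum_erase]
    exact hmin (fun j => u j) fun j => (u j).2
  let T : Finset (Fin n) := Finset.univ.filter fun j => ∃ t, P j t ≠ 0
  have hT : ∀ j, j ∈ T ↔ ∃ t, P j t ≠ 0 := fun j => by simp [T]
  have hQ : ∀ j ∈ T, ∃ t t', Q j t ≠ Q j t' := by
    intro j hj
    obtain ⟨t, ht⟩ := (hT j).1 hj
    by_contra! hconst
    refine right_ne_zero_of_mul ht (deriv_eq_zero_of_sq_eqOn isOpen_Ioo t.2 (hf1 j t t.2) ?_)
    exact fun x hx => sq_eq_sq_of_oddRoot_pow_eq hm (hf1 j x hx) (hf1 j t t.2) (hconst ⟨x, hx⟩ t)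
  have hcard : T.card ≤ 2 := card_le_two_of_separated_equation hsep T hT hQ fun j =>
    ⟨(a j + b j) / 2, by constructor <;> linarith [hab j]⟩
  refine ⟨Tᶜ, ?_, fun j hj t ht => ?_⟩
  · rw [Finset.card_compl, Fintype.card_fin]
    omega
  · rw [Finset.mem_compl, hT] at hj
    push Not at hj
    exact (mul_eq_zero.1 (hj ⟨t, ht⟩)).resolve_left
      (inv_ne_zero (pow_ne_zero _ (oddRoot_ne_zero m (hf1 j t ht))))
end

section
/- Let m be a positive integer, U ⊂ ℝ^n open, and f : U → ℝ smooth with all partial derivatives f_{u_i} nowhere zero on U. Define Φ(x) = Σ_{i=1}^{n+1} x_i^{2m} on ℝ^{n+1}, A = 1 + Σ_{i=1}^n (f_{u_i})^{2m/(2m-1)}, η = A^{-1/(2m)} (−(f_{u_1})^{1/(2m-1)}, …, −(f_{u_n})^{1/(2m-1)}, 1), and ν = (−f_{u_1}, …, −f_{u_n}, 1). Then at every point of U, the gradient of Φ at η equals 2m A^{-(2m-1)/(2m)} ν; in particular grad Φ(η) is a positive scalar multiple of ν, and hence grad Φ(η) is Euclidean-orthogonal to each tangent vector X_{u_j} = e_j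 + f_{u_j} e_{n+1} of the graph x_{n+1} = f(u_1,…,u_n). -/
/-- `Φ(x) = Σ_{i=1}^{n+1} x_i^{2m}` on `ℝ^{n+1}`. -/
noncomputable def Phi (m n : ℕ) (x : Fin (n + 1) → ℝ) : ℝ :=
  ∑ i, (x i) ^ (2 * m)

/-- The partial derivative `f_{u_i}` of `f : ℝⁿ → ℝ` at `x`. -/
noncomputable def pder (n : ℕ) (f : (Fin n → ℝ) → ℝ) (x : Fin n → ℝ) (i : Fin n) : ℝ :=
  fderiv ℝ f x (Pi.single i 1)

/-- `A = 1 + Σᵢ (f_{u_i})^{2m/(2m-1)}`. -/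
noncomputable def Afun (m n : ℕ) (f : (Fin n → ℝ) → ℝ) (x : Fin n → ℝ) : ℝ :=
  1 + ∑ i, (oddRoot m (pder n f x i)) ^ (2 * m)

/-- The Birkhoff–Gauss map
`η = A^{-1/(2m)} (-(f_{u_1})^{1/(2m-1)}, …, -(f_{u_n})^{1/(2m-1)}, 1)`. -/
noncomputable def etaMap (m n : ℕ) (f : (Fin n → ℝ) → ℝ) (x : Fin n → ℝ) :
    Fin (n + 1) → ℝ :=
  fun i => (Afun m n f x) ^ (-(1 : ℝ) / (2 * (m : ℝ)))
    * (Fin.snoc (fun k : Fin n => -(oddRoot m (pder n f x k))) 1 : Fin (n + 1) → ℝ) i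

/-- The Euclidean normal `ν = (-f_{u_1}, …, -f_{u_n}, 1)` of the graph. -/
noncomputable def nuMap (n : ℕ) (f : (Fin n → ℝ) → ℝ) (x : Fin n → ℝ) :
    Fin (n + 1) → ℝ :=
  (Fin.snoc (fun k : Fin n => -(pder n f x k)) 1 : Fin (n + 1) → ℝ)

/-- The tangent vector `X_{u_j} = e_j + f_{u_j} e_{n+1}` of the graph. -/
noncomputable def tangentVec (n : ℕ) (f : (Fin n → ℝ) → ℝ) (x : Fin n → ℝ) (j : Fin n) :
    Fin (n + 1) → ℝ :=
  (Fin.snoc (Pi.single j 1) (pder n f x j) : Fin (n + 1) → ℝ)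

theorem oddRoot_pow {m : ℕ} (hm : 1 ≤ m) (y : ℝ) : oddRoot m y ^ (2 * m - 1) = y := by
  have hodd : Odd (2 * m - 1) := ⟨m - 1, by omega⟩
  have hcast : (2 * (m : ℝ) - 1) = ((2 * m - 1 : ℕ) : ℝ) := by
    rw [Nat.cast_sub (by omega)]
    push_cast
    ring
  have hroot : (|y| ^ ((2 * (m : ℝ) - 1)⁻¹)) ^ (2 * m - 1) = |y| := by
    rw [hcast]
    exact Real.rpow_inv_natCast_pow (abs_nonneg y) (by omega)
  rw [oddRoot, mul_pow, hroot]
  rcases lt_trichotomy y 0 with h | rfl | h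
  · rw [Real.sign_of_neg h, hodd.neg_one_pow, abs_of_neg h]
    ring
  · simp
  · rw [Real.sign_of_pos h, one_pow, abs_of_pos h, one_mul]

theorem fderiv_Phi_single (m n : ℕ) (z : Fin (n + 1) → ℝ) (i : Fin (n + 1)) :
    fderiv ℝ (Phi m n) z (Pi.single i 1) = 2 * (m : ℝ) * z i ^ (2 * m - 1) := by
  have h : HasFDerivAt (Phi m n) (∑ j : Fin (n + 1),
      ((2 * m : ℕ) * z j ^ (2 * m - 1)) •
        (ContinuousLinearMap.proj j : (Fin (n + 1) → ℝ) →L[ℝ] ℝ)) z := by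
    refine HasFDerivAt.fun_sum fun j _ => ?_
    exact (hasDerivAt_pow (2 * m) (z j)).comp_hasFDerivAt z (hasFDerivAt_apply j z)
  rw [h.fderiv]
  simp [Pi.single_apply]

theorem Afun_pos (m n : ℕ) (f : (Fin n → ℝ) → ℝ) (x : Fin n → ℝ) : 0 < Afun m n f x :=
  add_pos_of_pos_of_nonneg one_pos
    (Finset.sum_nonneg fun i _ => (even_two_mul m).pow_nonneg (oddRoot m (pder n f x i)))

theorem etaMap_pow {m : ℕ} (hm : 1 ≤ m) (n : ℕ) (f : (Fin n → ℝ) → ℝ) (x : Fin n → ℝ)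
    (i : Fin (n + 1)) :
    etaMap m n f x i ^ (2 * m - 1) =
      Afun m n f x ^ (-(2 * (m : ℝ) - 1) / (2 * (m : ℝ))) * nuMap n f x i := by
  have hodd : Odd (2 * m - 1) := ⟨m - 1, by omega⟩
  rw [etaMap, mul_pow, ← Real.rpow_mul_natCast (Afun_pos m n f x).le]
  congr 1
  · congr 1
    rw [Nat.cast_sub (by omega)]
    push_cast
    ring
  · induction i using Fin.lastCases with
    | last => simp [nuMap]
    | cast k => simp [nuMap, hodd.neg_pow, oddRoot_pow hm]

theorem sum_nuMap_mul_tangentVec (n : ℕ) (f : (Fin n → ℝ) → ℝ) (x : Fin n → ℝ) (j : Fin n) :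
    ∑ i, nuMap n f x i * tangentVec n f x j i = 0 := by
  simp [Fin.sum_univ_castSucc, nuMap, tangentVec, Pi.single_apply]

/-- `grad Φ(η) = 2m A^{-(2m-1)/(2m)} ν`; in particular `grad Φ(η)`
is a positive scalar multiple of `ν` and is Euclidean-orthogonal to every
tangent vector `X_{u_j}` of the graph. -/
theorem gradPhi_eta_eq (m n : ℕ) (hm : 1 ≤ m)
    (U : Set (Fin n → ℝ)) (hU : IsOpen U)
    (f : (Fin n → ℝ) → ℝ) (hf : ContDiffOn ℝ (⊤ : ℕ∞) f U)
    (hfd : ∀ x ∈ U, ∀ i, pder n f x i ≠ 0) :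
    ∀ x ∈ U,
      (∀ i : Fin (n + 1),
        fderiv ℝ (Phi m n) (etaMap m n f x) (Pi.single i 1)
          = 2 * (m : ℝ) * (Afun m n f x) ^ (-(2 * (m : ℝ) - 1) / (2 * (m : ℝ)))
            * nuMap n f x i) ∧
      0 < 2 * (m : ℝ) * (Afun m n f x) ^ (-(2 * (m : ℝ) - 1) / (2 * (m : ℝ))) ∧
      (∀ j : Fin n,
        ∑ i : Fin (n + 1),
          fderiv ℝ (Phi m n) (etaMap m n f x) (Pi.single i 1) * tangentVec n f x j i
          = 0) := by
  intro x _
  have hgrad : ∀ i : Fin (n + 1),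
      fderiv ℝ (Phi m n) (etaMap m n f x) (Pi.single i 1)
        = 2 * (m : ℝ) * (Afun m n f x) ^ (-(2 * (m : ℝ) - 1) / (2 * (m : ℝ)))
          * nuMap n f x i := fun i => by
    rw [fderiv_Phi_single, etaMap_pow hm, ← mul_assoc]
  have hm' : (0 : ℝ) < m := by exact_mod_cast hm
  refine ⟨hgrad, mul_pos (by positivity) (Real.rpow_pos_of_pos (Afun_pos m n f x) _), fun j => ?_⟩
  simp_rw [hgrad, mul_assoc _ (nuMap n f x _)]
  rw [← Finset.mul_sum, sum_nuMap_mul_tangentVec, mul_zero]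
end

section
/- Let p_1,p_2,p_3,p_4 and q_1,q_2,q_3,q_4 be real numbers and set X_i(u) = p_i + q_i u (so X_i' = q_i). Then the identity Σ_{j=1}^{4} q_j · Σ_{i≠j} (p_i + q_i u_i) = 0 holds for all (u_1,u_2,u_3,u_4) ∈ ℝ^4 with u_1+u_2+u_3+u_4 = 0 if and only if the following four equations hold: q_1(p_2+p_3+p_4)+q_2(p_1+p_3+p_4)+q_3(p_1+p_2+p_4)+q_4(p_1+p_2+p_3) = 0, (q_2+q_3)(q_1−q_4) = 0, (q_1+q_3)(q_2−q_4) = 0, and (q_1+q_2)(q_3−q_4) = 0. -/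
/-- for affine data `Xᵢ(u) = pᵢ + qᵢ u` (`i = 1,…,4`), the separable
minimality identity `Σⱼ Xⱼ'(uⱼ) Σ_{i≠j} Xᵢ(uᵢ) = 0` on the hyperplane
`u₁+u₂+u₃+u₄ = 0` holds iff the coefficient equations (6.3) hold. -/
theorem affine_separable_minimality_iff (p q : Fin 4 → ℝ) :
    (∀ u : Fin 4 → ℝ, (∑ i, u i) = 0 →
        ∑ j, q j * ∑ i ∈ Finset.univ.erase j, (p i + q i * u i) = 0)
    ↔ (q 0 * (p 1 + p 2 + p 3) + q 1 * (p 0 + p 2 + p 3)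
          + q 2 * (p 0 + p 1 + p 3) + q 3 * (p 0 + p 1 + p 2) = 0
        ∧ (q 1 + q 2) * (q 0 - q 3) = 0
        ∧ (q 0 + q 2) * (q 1 - q 3) = 0
        ∧ (q 0 + q 1) * (q 2 - q 3) = 0) := by
  simp only [Finset.sum_erase_eq_sub (Finset.mem_univ _), Fin.sum_univ_four]
  constructor
  · intro h
    have h_zero := h ![0, 0, 0, 0] (by simp)
    have h_fst := h ![1, 0, 0, -1] (by simp)
    have h_snd := h ![0, 1, 0, -1] (by simp)
    have h_trd := h ![0, 0, 1, -1] (by simp)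
    simp at h_zero h_fst h_snd h_trd
    refine ⟨?_, ?_, ?_, ?_⟩
    · linear_combination h_zero
    · linear_combination h_fst - h_zero
    · linear_combination h_snd - h_zero
    · linear_combination h_trd - h_zero
  · rintro ⟨h_const, h_fst, h_snd, h_trd⟩ u hu
    linear_combination h_const + u 0 * h_fst + u 1 * h_snd + u 2 * h_trd
      + q 3 * (q 0 + q 1 + q 2) * hu
end

section
/- Let r_1, r_2, r_3, r_4 be real numbers with r_4 ≠ 0, r_1 + r_2 + r_3 = 0, r_1 r_2 = r_3 r_4, r_1 r_3 = r_2 r_4, and r_2 r_3 = r_1 r_4. Then r_1 = r_2 = r_3 = 0. -/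
/-- the algebraic lemma of case (ii-2): if `r₄ ≠ 0`,
`r₁+r₂+r₃ = 0`, `r₁r₂ = r₃r₄`, `r₁r₃ = r₂r₄` and `r₂r₃ = r₁r₄`, then
`r₁ = r₂ = r₃ = 0`. -/
theorem quadratic_coefficients_vanish (r₁ r₂ r₃ r₄ : ℝ)
    (h₄ : r₄ ≠ 0) (hsum : r₁ + r₂ + r₃ = 0)
    (h12 : r₁ * r₂ = r₃ * r₄) (h13 : r₁ * r₃ = r₂ * r₄) (h23 : r₂ * r₃ = r₁ * r₄) :
    r₁ = 0 ∧ r₂ = 0 ∧ r₃ = 0 := by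
  have hsq : r₁ ^ 2 + r₂ ^ 2 + r₃ ^ 2 = 0 := by
    linear_combination (r₁ + r₂ + r₃ - 2 * r₄) * hsum - 2 * (h12 + h13 + h23)
  refine ⟨?_, ?_, ?_⟩ <;> apply sq_eq_zero_iff.mp <;>
    linarith [sq_nonneg r₁, sq_nonneg r₂, sq_nonneg r₃]
end

section
/- Let p_1,…,p_5 and q_1,…,q_5 be real numbers and set X_i(u) = p_i + q_i u (so X_i' = q_i). Then the identity Σ_{j=1}^{5} q_j · Σ_{i≠j} (p_i + q_i u_i) = 0 holds for all (u_1,…,u_5) ∈ ℝ^5 with u_1+⋯+u_5 = 0 if and only if the following five equations hold: q_1(p_2+p_3+p_4+p_5)+q_2(p_1+p_3+p_4+p_5)+q_3(p_1+p_2+p_4+p_5)+q_4(p_1+p_2+p_3+p_5)+q_5(p_1+p_2+p_3+p_4) = 0, (q_2+q_3+q_4)(q_1−q_5) = 0, (q_1+q_3+q_4)(q_2−q_5) = 0, (q_1+q_2+q_4)(q_3−q_5) = 0, and (q_1+q_2+q_3)(q_4−q_5) = 0. -/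
/-- for affine data `Xᵢ(u) = pᵢ + qᵢ u` (`i = 1,…,5`), the separable
minimality identity `Σⱼ Xⱼ'(uⱼ) Σ_{i≠j} Xᵢ(uᵢ) = 0` on the hyperplane
`u₁+⋯+u₅ = 0` holds iff the coefficient equations (6.4) hold. -/
theorem affine_separable_minimality_iff_dim5 (p q : Fin 5 → ℝ) :
    (∀ u : Fin 5 → ℝ, (∑ i, u i) = 0 →
        ∑ j, q j * ∑ i ∈ Finset.univ.erase j, (p i + q i * u i) = 0)
    ↔ (q 0 * (p 1 + p 2 + p 3 + p 4) + q 1 * (p 0 + p 2 + p 3 + p 4)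
          + q 2 * (p 0 + p 1 + p 3 + p 4) + q 3 * (p 0 + p 1 + p 2 + p 4)
          + q 4 * (p 0 + p 1 + p 2 + p 3) = 0
        ∧ (q 1 + q 2 + q 3) * (q 0 - q 4) = 0
        ∧ (q 0 + q 2 + q 3) * (q 1 - q 4) = 0
        ∧ (q 0 + q 1 + q 3) * (q 2 - q 4) = 0
        ∧ (q 0 + q 1 + q 2) * (q 3 - q 4) = 0) := by
  have expand (u : Fin 5 → ℝ) :
      ∑ j, q j * ∑ i ∈ Finset.univ.erase j, (p i + q i * u i) =
        ∑ j, q j * (∑ i, (p i + q i * u i) - (p j + q j * u j)) :=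
    Finset.sum_congr rfl fun j _ => by rw [Finset.sum_erase_eq_sub (Finset.mem_univ j)]
  simp only [expand, Fin.sum_univ_five]
  constructor
  · intro h
    have h0 := h ![0, 0, 0, 0, 0] (by simp)
    have h1 := h ![1, 0, 0, 0, -1] (by simp)
    have h2 := h ![0, 1, 0, 0, -1] (by simp)
    have h3 := h ![0, 0, 1, 0, -1] (by simp)
    have h4 := h ![0, 0, 0, 1, -1] (by simp)
    simp only [Matrix.cons_val] at h0 h1 h2 h3 h4
    refine ⟨?_, ?_, ?_, ?_, ?_⟩
    · linear_combination h0
    · linear_combination h1 - h0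
    · linear_combination h2 - h0
    · linear_combination h3 - h0
    · linear_combination h4 - h0
  · rintro ⟨h0, h1, h2, h3, h4⟩ u hu
    linear_combination h0 + u 0 * h1 + u 1 * h2 + u 2 * h3 + u 3 * h4 +
      q 4 * (q 0 + q 1 + q 2 + q 3) * hu
end

section
/- Let q_1,…,q_4 and r_1,…,r_4 be real numbers and set X_i(u) = q_i e^u + r_i e^{−u} (so X_i'(u) = q_i e^u − r_i e^{−u}). Then the identity Σ_{j=1}^{4} X_j'(u_j) · Σ_{i≠j} X_i(u_i) = 0 holds for all (u_1,u_2,u_3,u_4) ∈ ℝ^4 with u_1+u_2+u_3+u_4 = 0 if and only if the following six equations hold: q_1 q_2 = r_3 r_4, q_3 q_4 = r_1 r_2, q_1 q_3 = r_2 r_4, q_2 q_4 = r_1 r_3, q_2 q_3 = r_1 r_4, and q_1 q_4 = r_2 r_3. -/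
/-- On the hyperplane `u₁+u₂+u₃+u₄ = 0` the minimality expression for exponential data is a
combination of the exponentials of the pairwise sums. -/
lemma exponential_minimality_sum_eq (q r u : Fin 4 → ℝ) (hu : ∑ i, u i = 0) :
    ∑ j, (q j * Real.exp (u j) - r j * Real.exp (-u j))
          * ∑ i ∈ Finset.univ.erase j,
              (q i * Real.exp (u i) + r i * Real.exp (-u i))
      = 2 * ((q 0 * q 1 - r 2 * r 3) * Real.exp (u 0 + u 1)
        + (q 2 * q 3 - r 0 * r 1) * Real.exp (-(u 0 + u 1))
        + ((q 0 * q 2 - r 1 * r 3) * Real.exp (u 0 + u 2)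
        + (q 1 * q 3 - r 0 * r 2) * Real.exp (-(u 0 + u 2)))
        + ((q 0 * q 3 - r 1 * r 2) * Real.exp (u 0 + u 3)
        + (q 1 * q 2 - r 0 * r 3) * Real.exp (-(u 0 + u 3)))) := by
  rw [Fin.sum_univ_four] at hu
  have key {a b c d : ℝ} (h : a + b + c + d = 0) :
      Real.exp (a + b) = Real.exp (-c) * Real.exp (-d) := by
    rw [← Real.exp_add]
    congr 1
    linarith
  have key' {a b c d : ℝ} (h : a + b + c + d = 0) :
      Real.exp (-(a + b)) = Real.exp c * Real.exp d := by
    rw [← Real.exp_add]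
    congr 1
    linarith
  have h01 := key hu
  have h02 := key (a := u 0) (b := u 2) (c := u 1) (d := u 3) (by linarith)
  have h03 := key (a := u 0) (b := u 3) (c := u 1) (d := u 2) (by linarith)
  have k01 := key' hu
  have k02 := key' (a := u 0) (b := u 2) (c := u 1) (d := u 3) (by linarith)
  have k03 := key' (a := u 0) (b := u 3) (c := u 1) (d := u 2) (by linarith)
  simp only [Finset.sum_erase_eq_sub (Finset.mem_univ _), Fin.sum_univ_four]
  rw [k01, k02, k03]
  rw [Real.exp_add] at h01 h02 h03
  simp only [neg_add, Real.exp_add] at k01 k02 k03 ⊢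
  linear_combination (-2 * r 2 * r 3) * h01.symm + (-2 * r 1 * r 3) * h02.symm
    + (-2 * r 1 * r 2) * h03.symm + (-2 * r 0 * r 1) * k01
    + (-2 * r 0 * r 2) * k02 + (-2 * r 0 * r 3) * k03

/-- A combination of `eᵗ` and `e⁻ᵗ` is constant only if both coefficients vanish. -/
lemma exp_coeffs_eq_zero_of_const {A B c : ℝ}
    (h : ∀ t : ℝ, A * Real.exp t + B * Real.exp (-t) = c) : A = 0 ∧ B = 0 := by
  have h1 := h 0
  have h2 := h (Real.log 2)
  have h4 := h (Real.log 4)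
  rw [Real.exp_neg, Real.exp_log (by norm_num)] at h2 h4
  norm_num at h1 h2 h4
  constructor <;> linarith

/-- for exponential data `Xᵢ(u) = qᵢ eᵘ + rᵢ e⁻ᵘ` (`i = 1,…,4`), the
separable minimality identity `Σⱼ Xⱼ'(uⱼ) Σ_{i≠j} Xᵢ(uᵢ) = 0` on the hyperplane
`u₁+u₂+u₃+u₄ = 0` holds iff the six coefficient equations of (6.5) hold. -/
theorem exponential_separable_minimality_iff (q r : Fin 4 → ℝ) :
    (∀ u : Fin 4 → ℝ, (∑ i, u i) = 0 →
        ∑ j, (q j * Real.exp (u j) - r j * Real.exp (-u j))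
          * ∑ i ∈ Finset.univ.erase j,
              (q i * Real.exp (u i) + r i * Real.exp (-u i)) = 0)
    ↔ (q 0 * q 1 = r 2 * r 3 ∧ q 2 * q 3 = r 0 * r 1
        ∧ q 0 * q 2 = r 1 * r 3 ∧ q 1 * q 3 = r 0 * r 2
        ∧ q 1 * q 2 = r 0 * r 3 ∧ q 0 * q 3 = r 1 * r 2) := by
  constructor
  · intro h
    have H (a b c : ℝ) := h ![(a + b + c) / 2, (a - b - c) / 2, (b - a - c) / 2, (c - a - b) / 2]
      (by simp [Fin.sum_univ_four]; ring)
    have H' (a b c : ℝ) :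
        (q 0 * q 1 - r 2 * r 3) * Real.exp a + (q 2 * q 3 - r 0 * r 1) * Real.exp (-a)
        + ((q 0 * q 2 - r 1 * r 3) * Real.exp b + (q 1 * q 3 - r 0 * r 2) * Real.exp (-b))
        + ((q 0 * q 3 - r 1 * r 2) * Real.exp c
          + (q 1 * q 2 - r 0 * r 3) * Real.exp (-c)) = 0 := by
      have e := H a b c
      rw [exponential_minimality_sum_eq _ _ _ (by simp [Fin.sum_univ_four]; ring)] at e
      simp only [Matrix.cons_val] at e
      rw [show (a + b + c) / 2 + (a - b - c) / 2 = a by ring,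
        show (a + b + c) / 2 + (b - a - c) / 2 = b by ring,
        show (a + b + c) / 2 + (c - a - b) / 2 = c by ring] at e
      linarith
    obtain ⟨h1, h2⟩ := exp_coeffs_eq_zero_of_const fun t =>
      eq_neg_of_add_eq_zero_left ((add_assoc _ _ _).symm.trans (H' t 0 0))
    obtain ⟨h3, h4⟩ := exp_coeffs_eq_zero_of_const fun t =>
      eq_neg_of_add_eq_zero_right ((add_right_comm _ _ _).trans (H' 0 t 0))
    obtain ⟨h5, h6⟩ := exp_coeffs_eq_zero_of_const fun t =>
      eq_neg_of_add_eq_zero_right (H' 0 0 t)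
    refine ⟨?_, ?_, ?_, ?_, ?_, ?_⟩ <;> linarith
  · rintro ⟨h1, h2, h3, h4, h5, h6⟩ u hu
    rw [exponential_minimality_sum_eq q r u hu, h1, h2, h3, h4, h5, h6]
    ring
end
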